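/- Let α > 0, let r ∈ ℝ^d be a unit vector, let μ = (α/(α+2))^{1/2}, and let M = E[exp(-⟨r,z⟩²/α) z zᵀ] where z ~ N(0, I_d). Then M = μ(I_d - (1-μ²) r rᵀ). -/

import Mathlib

open MeasureTheory ProbabilityTheory Matrix

/-- Multiplying a standard Gaussian by `exp (-t²/α)` gives, up to the factor `(α/(α+2))^{1/2}`, a
centered Gaussian of variance `α/(α+2)`. -/
lemma integral_exp_neg_sq_div_mul_gaussianReal {α : ℝ} (hα : 0 < α) (v : NNReal)
    (hv : (v : ℝ) = α / (α + 2)) (f : ℝ → ℝ) :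
    ∫ t, Real.exp (-t ^ 2 / α) * f t ∂(gaussianReal 0 1) =
      √(v : ℝ) * ∫ t, f t ∂(gaussianReal 0 v) := by
  have hv_pos : (0 : ℝ) < v := by rw [hv]; positivity
  have hv_ne : v ≠ 0 := by rintro rfl; simp at hv_pos
  rw [integral_gaussianReal_eq_integral_smul one_ne_zero,
    integral_gaussianReal_eq_integral_smul hv_ne, ← integral_const_mul]
  congr 1 with t
  simp only [gaussianPDFReal, smul_eq_mul, NNReal.coe_one, mul_one, sub_zero]
  rw [Real.sqrt_mul (by positivity) (v : ℝ), mul_inv]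
  have hs : √(v : ℝ) ≠ 0 := by positivity
  have he : Real.exp (-t ^ 2 / (2 * v)) =
      Real.exp (-t ^ 2 / 2) * Real.exp (-t ^ 2 / α) := by
    rw [← Real.exp_add, hv]
    congr 1
    field_simp
    ring
  rw [he]
  field_simp

lemma integral_sq_gaussianReal_zero (v : NNReal) : ∫ t, t * t ∂(gaussianReal 0 v) = v := by
  have h := variance_fun_id_gaussianReal (μ := 0) (v := v)
  rw [variance_eq_integral (by fun_prop), integral_id_gaussianReal] at h
  simpa [sq] using h

lemma prod_ite_mul_ite {ι : Type*} [Fintype ι] [DecidableEq ι] (k l : ι) (x : ι → ℝ) :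
    ∏ m, ((if m = k then x m else 1) * (if m = l then x m else 1)) = x k * x l := by
  rw [Finset.prod_mul_distrib]
  simp

/-- Second moments of a product Gaussian weighted by `exp (-x i ^ 2 / α)` in one coordinate. -/
lemma integral_exp_neg_sq_div_mul_pi_gaussianReal {ι : Type*} [Fintype ι] [DecidableEq ι]
    {α : ℝ} (hα : 0 < α) (v : NNReal) (hv : (v : ℝ) = α / (α + 2)) (i k l : ι) :
    ∫ x : ι → ℝ, Real.exp (-x i ^ 2 / α) * (x k * x l)
        ∂(Measure.pi fun _ : ι ↦ gaussianReal 0 1) =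
      √(v : ℝ) * if k = l then (if k = i then (v : ℝ) else 1) else 0 := by
  let g : ι → ℝ → ℝ := fun m t ↦ (if m = k then t else 1) * (if m = l then t else 1)
  let w : ι → NNReal := fun m ↦ if m = i then v else 1
  have h_prod (x : ι → ℝ) : Real.exp (-x i ^ 2 / α) * (x k * x l) =
      ∏ m, (if m = i then Real.exp (-x m ^ 2 / α) else 1) * g m (x m) := by
    rw [Finset.prod_mul_distrib, prod_ite_mul_ite]
    simp
  simp_rw [h_prod]
  rw [integral_fintype_prod_eq_prod
    (f := fun m t ↦ (if m = i then Real.exp (-t ^ 2 / α) else 1) * g m t)]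
  have h_fac (m : ι) : ∫ t, (if m = i then Real.exp (-t ^ 2 / α) else 1) * g m t
        ∂(gaussianReal 0 1) =
      (if m = i then √(v : ℝ) else 1) * ∫ t, g m t ∂(gaussianReal 0 (w m)) := by
    by_cases hm : m = i
    · simp [hm, w, integral_exp_neg_sq_div_mul_gaussianReal hα v hv]
    · simp [hm, w]
  simp_rw [h_fac, Finset.prod_mul_distrib]
  rw [Finset.prod_ite_eq' Finset.univ i, if_pos (Finset.mem_univ i)]
  congr 1
  by_cases hkl : k = l
  · subst hkl
    have h_int (m : ι) : ∫ t, g m t ∂(gaussianReal 0 (w m)) =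
        if m = k then (w m : ℝ) else 1 := by
      by_cases hm : m = k
      · simp [g, hm, integral_sq_gaussianReal_zero]
      · simp [g, hm]
    simp_rw [h_int]
    by_cases hki : k = i <;> simp [w, hki]
  · rw [if_neg hkl]
    refine Finset.prod_eq_zero (Finset.mem_univ k) ?_
    simp [g, hkl, integral_id_gaussianReal]

lemma integrable_exp_neg_sq_div_mul_pi_gaussianReal {ι : Type*} [Fintype ι]
    {α : ℝ} (hα : 0 < α) (i k l : ι) :
    Integrable (fun x : ι → ℝ ↦ Real.exp (-x i ^ 2 / α) * (x k * x l))
      (Measure.pi fun _ : ι ↦ gaussianReal 0 1) := by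
  have h_coord (m : ι) : MemLp (fun x : ι → ℝ ↦ x m) 2
      (Measure.pi fun _ : ι ↦ gaussianReal 0 1) :=
    (memLp_id_gaussianReal (μ := 0) (v := 1) 2).comp_measurePreserving
      (measurePreserving_eval (fun _ : ι ↦ gaussianReal 0 1) m)
  refine ((h_coord k).integrable_mul (h_coord l)).bdd_mul (c := 1)
    (by fun_prop : Measurable fun x : ι → ℝ ↦ Real.exp (-x i ^ 2 / α)).aestronglyMeasurable
    (Filter.Eventually.of_forall fun x ↦ ?_)
  rw [Real.norm_of_nonneg (Real.exp_nonneg _), Real.exp_le_one_iff, neg_div, neg_nonpos]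
  positivity

/-- The product of standard Gaussians is invariant under an orthonormal change of coordinates. -/
lemma integral_pi_gaussianReal_eq_orthonormalBasis {ι : Type*} [Fintype ι]
    (b : OrthonormalBasis ι ℝ (EuclideanSpace ℝ ι)) {f : (ι → ℝ) → ℝ} (hf : Measurable f) :
    ∫ z, f z ∂(Measure.pi fun _ : ι ↦ gaussianReal 0 1) =
      ∫ x : ι → ℝ, f (fun i ↦ ∑ k, x k * b k i)
        ∂(Measure.pi fun _ : ι ↦ gaussianReal 0 1) := by
  have hf' : Measurable fun y : EuclideanSpace ℝ ι ↦ f (WithLp.ofLp y) := hf.comp (by fun_prop)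
  have h := congrArg (fun ν ↦ ∫ y, f (WithLp.ofLp y) ∂ν)
    (map_pi_eq_stdGaussian.trans (stdGaussian_eq_map_pi_orthonormalBasis b))
  rw [integral_map (by fun_prop) hf'.aestronglyMeasurable,
    integral_map (Measurable.aemeasurable (by fun_prop)) hf'.aestronglyMeasurable] at h
  refine h.trans (integral_congr_ae (Filter.Eventually.of_forall fun x ↦ ?_))
  refine congrArg f (funext fun i ↦ ?_)
  simp

lemma exists_orthonormalBasis_apply_eq {ι : Type*} [Fintype ι] (r : EuclideanSpace ℝ ι)
    (hr : ‖r‖ = 1) (i : ι) :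
    ∃ b : OrthonormalBasis ι ℝ (EuclideanSpace ℝ ι), b i = r := by
  have h : Orthonormal ℝ (({i} : Set ι).domRestrict fun _ ↦ r) :=
    ⟨fun _ ↦ hr, fun x y hxy ↦ (hxy (Subsingleton.elim x y)).elim⟩
  obtain ⟨b, hb⟩ := h.exists_orthonormalBasis_extension_of_card_eq finrank_euclideanSpace
  exact ⟨b, hb i rfl⟩

/-- Lemma (FLOW): for a unit vector `r`, `z ~ N(0, I_d)`, and `μ = (α/(α+2))^{1/2}`,
`M = E[exp(-⟨r,z⟩²/α) z zᵀ] = μ (I_d - (1-μ²) r rᵀ)`. -/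
theorem stmt_5 (d : ℕ) (α : ℝ) (hα : 0 < α)
    (r : Fin d → ℝ) (hr : r ⬝ᵥ r = 1)
    (μ : ℝ) (hμ : μ = (α / (α + 2)) ^ ((1 : ℝ) / 2))
    (M : Matrix (Fin d) (Fin d) ℝ)
    (hM : ∀ i j, M i j =
      ∫ z : Fin d → ℝ, Real.exp (-(r ⬝ᵥ z) ^ 2 / α) * (z i * z j)
        ∂(Measure.pi fun _ : Fin d => gaussianReal 0 1)) :
    M = μ • ((1 : Matrix (Fin d) (Fin d) ℝ) - (1 - μ ^ 2) • vecMulVec r r) := by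
  let v : NNReal := ⟨α / (α + 2), by positivity⟩
  have hv : (v : ℝ) = α / (α + 2) := rfl
  have hμv : μ = √(v : ℝ) := by rw [hμ, hv, Real.sqrt_eq_rpow]
  have hμsq : μ ^ 2 = v := by rw [hμv, Real.sq_sqrt v.coe_nonneg]
  ext i j
  obtain ⟨b, hb⟩ := exists_orthonormalBasis_apply_eq (WithLp.toLp 2 r)
    (by rw [EuclideanSpace.norm_eq, Real.sqrt_eq_one, ← hr]; simp [dotProduct, ← sq]) i
  have hr_apply (m : Fin d) : r m = b i m := by rw [hb]
  have h_inner (x : Fin d → ℝ) : r ⬝ᵥ (fun m ↦ ∑ k, x k * b k m) = x i := by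
    have h (k : Fin d) : ∑ m, r m * b k m = if i = k then 1 else 0 := by
      rw [← b.inner_eq_ite i k, PiLp.inner_apply]
      simp [hr_apply, mul_comm]
    simp_rw [dotProduct, Finset.mul_sum]
    rw [Finset.sum_comm]
    simp_rw [mul_left_comm (r _) (x _), ← Finset.mul_sum, h]
    simp
  have h_one : ∑ k, b k i * b k j = (1 : Matrix (Fin d) (Fin d) ℝ) i j := by
    have h := b.sum_inner_mul_inner (EuclideanSpace.single i 1) (EuclideanSpace.single j 1)
    simpa [EuclideanSpace.inner_single_left, EuclideanSpace.inner_single_right,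
      Matrix.one_apply, eq_comm] using h
  rw [hM, integral_pi_gaussianReal_eq_orthonormalBasis b (by unfold dotProduct; fun_prop)]
  have h_expand (x : Fin d → ℝ) :
      Real.exp (-(r ⬝ᵥ fun m ↦ ∑ k, x k * b k m) ^ 2 / α) *
          ((∑ k, x k * b k i) * ∑ k, x k * b k j) =
        ∑ k, ∑ l, b k i * b l j * (Real.exp (-x i ^ 2 / α) * (x k * x l)) := by
    rw [h_inner, Finset.sum_mul_sum, Finset.mul_sum]
    refine Finset.sum_congr rfl fun k _ ↦ ?_
    rw [Finset.mul_sum]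
    exact Finset.sum_congr rfl fun l _ ↦ by ring
  have h_int (k l : Fin d) :=
    (integrable_exp_neg_sq_div_mul_pi_gaussianReal hα i k l).const_mul (b k i * b l j)
  simp_rw [h_expand]
  rw [integral_finsetSum _ fun k _ ↦ integrable_finsetSum _ fun l _ ↦ h_int k l]
  simp_rw [integral_finsetSum _ fun l _ ↦ h_int _ l, integral_const_mul,
    integral_exp_neg_sq_div_mul_pi_gaussianReal hα v hv, ← hμv, ← hμsq]
  have h_sum : ∑ k, b k i * b k j * (μ * if k = i then μ ^ 2 else 1) =
      μ * (∑ k, b k i * b k j - (1 - μ ^ 2) * (b i i * b i j)) := by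
    have h (k : Fin d) : b k i * b k j * (μ * if k = i then μ ^ 2 else 1) =
        μ * (b k i * b k j) - if k = i then μ * ((1 - μ ^ 2) * (b k i * b k j)) else 0 := by
      split_ifs <;> ring
    simp_rw [h, Finset.sum_sub_distrib, ← Finset.mul_sum]
    rw [Finset.sum_ite_eq' Finset.univ i, if_pos (Finset.mem_univ i)]
    ring
  simp only [mul_ite, mul_zero, Finset.sum_ite_eq, Finset.mem_univ, if_true] at h_sum ⊢
  rw [h_sum, h_one]
  simp [vecMulVec_apply, hr_apply]
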